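/- The code L(17) (of length 36) contains exactly 888 codewords of weight 36, and these are exactly: the all-one vector 1̄ and the vector 2·1̄; 70 codewords having exactly 18 coordinates equal to 1 and 18 coordinates equal to 2, namely the rows of H and of 2H (reduced mod 3) other than 1̄ and 2·1̄, where H = [[I_{18} − U_{17}ᵀ, U_{17} + I_{18}], [I_{18} + U_{17}ᵀ, U_{17} − I_{18}]]; exactly 408 codewords having exactly 15 coordinates equal to 1 and 21 coordinates equal to 2; and exactly 408 codewords having exactly 21 coordinates equal to 1 and 15 coordinates equal to 2. -/

import Mathlib

open Matrix Finset

/-- The Pless matrix `S_q`, with rows and columns indexed by `GF(q) ∪ {∞}`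
(`none` playing the role of `∞`), built from the quadratic character of `GF(q)`. -/
def Smat (F : Type) [Field F] [Fintype F] [DecidableEq F] :
    Matrix (Option F) (Option F) ℤ := fun i j =>
  match i, j with
  | none, none => 0
  | none, some _ => 1
  | some _, none => quadraticChar F (-1)
  | some a, some b => quadraticChar F (a - b)

/-- The matrix `U_q`, obtained from `S_q` by replacing each entry `s_{a,∞}`
(`a ∈ GF(q)`) in the column labeled `∞` by `-1`. -/
def Umat (F : Type) [Field F] [Fintype F] [DecidableEq F] :
    Matrix (Option F) (Option F) ℤ := fun i j =>
  match i, j with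
  | some _, none => -1
  | i, j => Smat F i j

/-- The row of the generator matrix `(I | U_q)` of the code `L(q)`,
reduced modulo 3, indexed by `i : Option F`. -/
def genRowL (F : Type) [Field F] [Fintype F] [DecidableEq F] (i : Option F) :
    (Option F ⊕ Option F) → ZMod 3 := fun j =>
  match j with
  | Sum.inl k => if i = k then 1 else 0
  | Sum.inr k => ((Umat F i k : ℤ) : ZMod 3)

/-- The code `L(q)`: the ternary code of length `2q+2` spanned by the rows of
`(I | U_q)` reduced modulo 3; it is monomially equivalent to the Pless symmetry code. -/
def Lcode (F : Type) [Field F] [Fintype F] [DecidableEq F] :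
    Submodule (ZMod 3) ((Option F ⊕ Option F) → ZMod 3) :=
  Submodule.span (ZMod 3) (Set.range (genRowL F))

/-- The Hadamard matrix `H = [[I − U_qᵀ, U_q + I], [I + U_qᵀ, U_q − I]]`. -/
def Hmat (F : Type) [Field F] [Fintype F] [DecidableEq F] :
    Matrix (Option F ⊕ Option F) (Option F ⊕ Option F) ℤ :=
  Matrix.fromBlocks (1 - (Umat F)ᵀ) (Umat F + 1) (1 + (Umat F)ᵀ) (Umat F - 1)

instance : Fact (Nat.Prime 17) := ⟨by norm_num⟩

/-- Number of coordinates of `c` equal to `v`. -/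
def cnt (c : (Option (ZMod 17) ⊕ Option (ZMod 17)) → ZMod 3) (v : ZMod 3) : ℕ :=
  (Finset.univ.filter (fun j => c j = v)).card

/-- The entries of `U_17` modulo 3 as natural numbers, read off from the base 4 digits of a
constant: the index `0` stands for `∞` and `a + 1` for `a ∈ GF(17)`. -/
def entry (i j : ℕ) : ℕ :=
  102269136428457444963321394944329856595122669013259730768561323649201094672694087686472953715844019889495377533959578950277143417629158708221403541281459797457485379282751619394514596948696454484 >>>
    (36 * i + 2 * j) % 4

/-- The entry in column `j` of the combination, with coefficients `m`, of the rows of `U_17`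
starting with row `o`. -/
def dot : List ℕ → ℕ → ℕ → ℕ := fun m o j =>
  List.rec (fun _ => 0) (fun x _ r o => x * entry o j + r (o + 1)) m o

/-- All lists of length `n` with entries `1` and `2`. -/
def messages : ℕ → List (List ℕ)
  | 0 => [[]]
  | n + 1 => (messages n).map (List.cons 1) ++ (messages n).map (List.cons 2)

/-- A number whose octal digits are the powers of two with the given exponents. -/
def oneHot : List ℕ → ℕ
  | [] => 0
  | d :: ds => 2 ^ d + 8 * oneHot ds

/-- The one-hot word of `c` times a combination of rows of `U_17`. -/
def word (c : ℕ) (m : List ℕ) (o : ℕ) : ℕ :=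
  oneHot ((List.range 18).map fun j => c * dot m o j % 3)

/-- The number of coordinates equal to `1` in the codeword with message `m`. -/
def ones (m : List ℕ) : ℕ :=
  (List.range 18).countP (fun j => (m.getD j 0 % 3).beq 1) +
    (List.range 18).countP (fun j => (dot m 0 j % 3).beq 1)

/-- `k n`, arranged so that the kernel evaluates `n` first. -/
def forceNat {α : Type} (n : ℕ) (k : ℕ → α) : α :=
  Nat.rec (k 0) (fun n _ => k (n + 1)) n

/-- `k (l.map f)`, arranged so that the kernel evaluates the first components first. -/
def forceList {α β : Type} (f : β → ℕ) : List β → (List (ℕ × β) → α) → α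
  | [], k => k []
  | b :: l, k => forceNat (f b) fun n => forceList f l fun l' => k ((n, b) :: l')

/-- The messages, extending a prefix with one-hot word `h`, of codewords of full weight. -/
def search (h : ℕ) (a : List ℕ) (l : List (ℕ × List ℕ)) (acc : List (List ℕ)) : List (List ℕ) :=
  List.rec acc (fun p _ r => bif (Nat.land h p.1).beq 0 then (a ++ p.2) :: r else r) l

/-- The messages of the codewords of full weight, found by meeting in the middle. -/
def survivors : List (List ℕ) :=
  forceList (fun b => word 2 b 9) (messages 9) fun l =>
    (messages 9).foldr (fun a acc => forceNat (word 1 a 0) fun h => search h a l acc) []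

/-- The length of a list and its numbers of entries `15`, `18` and `21`. -/
def tally (l : List ℕ) : List ℕ :=
  [l.length, l.countP fun n => n.beq 15, l.countP fun n => n.beq 18, l.countP fun n => n.beq 21]

/-- The tally of the numbers of ones in the codewords with the given messages. -/
def tallies (l : List (List ℕ)) : List ℕ :=
  forceList ones l fun l => tally (l.map Prod.fst)

@[simp] lemma dot_nil (o j : ℕ) : dot [] o j = 0 := rfl

@[simp] lemma dot_cons (x : ℕ) (m : List ℕ) (o j : ℕ) :
    dot (x :: m) o j = x * entry o j + dot m (o + 1) j := rfl

lemma dot_append (a b : List ℕ) (o j : ℕ) :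
    dot (a ++ b) o j = dot a o j + dot b (o + a.length) j := by
  induction a generalizing o with
  | nil => simp
  | cons x a ih => simp [ih, add_assoc, add_comm 1]

lemma dot_eq_sum (m : List ℕ) (o j : ℕ) :
    dot m o j = ∑ i ∈ range m.length, m.getD i 0 * entry (o + i) j := by
  induction m generalizing o with
  | nil => simp
  | cons x m ih => simp [ih, sum_range_succ', add_comm, add_left_comm]

lemma forceNat_eq {α : Type} (n : ℕ) (k : ℕ → α) : forceNat n k = k n := by
  cases n <;> rfl

lemma forceList_eq {α β : Type} (f : β → ℕ) (l : List β) (k : List (ℕ × β) → α) :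
    forceList f l k = k (l.map fun b => (f b, b)) := by
  induction l generalizing k with
  | nil => rfl
  | cons b l ih => simp [forceList, forceNat_eq, ih]

lemma mem_messages {n : ℕ} {m : List ℕ} :
    m ∈ messages n ↔ m.length = n ∧ ∀ x ∈ m, x = 1 ∨ x = 2 := by
  induction n generalizing m with
  | zero => cases m <;> simp [messages]
  | succ n ih => cases m with
    | nil => simp [messages]
    | cons x m => simp [messages, ih]; grind

lemma nodup_messages (n : ℕ) : (messages n).Nodup := by
  induction n with
  | zero => simp [messages]
  | succ n ih =>
    refine List.nodup_append.2 ⟨ih.map (List.cons_injective), ih.map (List.cons_injective), ?_⟩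
    simp

lemma messages_add (a b : ℕ) :
    messages (a + b) = (messages a).flatMap fun s => (messages b).map (s ++ ·) := by
  induction a with
  | zero => simp [messages]
  | succ a ih => simp [Nat.succ_add, messages, ih, List.map_flatMap, List.flatMap_map, Function.comp_def]

lemma land_add_eight_mul_eq_zero {p q : ℕ} (hp : p < 8) (hq : q < 8) (x y : ℕ) :
    (p + 8 * x) &&& (q + 8 * y) = 0 ↔ p &&& q = 0 ∧ x &&& y = 0 := by
  have hdiv := Nat.and_div_two_pow (a := p + 8 * x) (b := q + 8 * y) (n := 3)
  have hmod := Nat.and_mod_two_pow (a := p + 8 * x) (b := q + 8 * y) (n := 3)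
  rw [show 2 ^ 3 = 8 from rfl] at hdiv hmod
  rw [show (p + 8 * x) / 8 = x by omega, show (q + 8 * y) / 8 = y by omega] at hdiv
  rw [show (p + 8 * x) % 8 = p by omega, show (q + 8 * y) % 8 = q by omega] at hmod
  rw [← hdiv, ← hmod]
  omega

lemma land_oneHot_eq_zero (l : List ℕ) (f g : ℕ → ℕ) (hf : ∀ j, f j < 3) (hg : ∀ j, g j < 3) :
    oneHot (l.map f) &&& oneHot (l.map g) = 0 ↔ ∀ j ∈ l, f j ≠ g j := by
  induction l with
  | nil => simp [oneHot]
  | cons i l ih =>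
    have hlt : ∀ d < 3, 2 ^ d < 8 := by decide
    have hne : ∀ d < 3, ∀ e < 3, 2 ^ d &&& 2 ^ e = 0 ↔ d ≠ e := by decide
    simp only [List.map_cons, oneHot, List.forall_mem_cons, ih, hne _ (hf i) _ (hg i),
      land_add_eight_mul_eq_zero (hlt _ (hf i)) (hlt _ (hg i))]

lemma land_word_eq_zero {a b : List ℕ} (h : a.length = 9) :
    Nat.land (word 1 a 0) (word 2 b 9) = 0 ↔ ∀ j : Fin 18, dot (a ++ b) 0 j % 3 ≠ 0 := by
  have := land_oneHot_eq_zero (List.range 18) (fun j => 1 * dot a 0 j % 3)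
    (fun j => 2 * dot b 9 j % 3) (fun j => by omega) (fun j => by omega)
  refine this.trans ?_
  simp only [List.mem_range, dot_append, h, Fin.forall_iff]
  refine forall₂_congr fun j _ => not_congr ?_
  rw [zero_add]
  omega

lemma search_eq (h : ℕ) (a : List ℕ) (l : List (ℕ × List ℕ)) (acc : List (List ℕ)) :
    search h a l acc =
      (l.filter fun p => (Nat.land h p.1).beq 0).map (fun p => a ++ p.2) ++ acc := by
  induction l with
  | nil => rfl
  | cons p l ih =>
    change (bif (Nat.land h p.1).beq 0 then (a ++ p.2) :: search h a l acc
      else search h a l acc) = _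
    rw [List.filter_cons, ih]
    cases (Nat.land h p.1).beq 0 <;> simp

lemma survivors_eq :
    survivors = (messages (9 + 9)).filter fun m => decide (∀ j : Fin 18, dot m 0 j % 3 ≠ 0) := by
  have aux : ∀ l : List (List ℕ), (∀ a ∈ l, a.length = 9) →
      l.foldr (fun a acc => forceNat (word 1 a 0) fun h =>
        search h a ((messages 9).map fun b => (word 2 b 9, b)) acc) [] =
      (l.flatMap fun s => (messages 9).map (s ++ ·)).filter
        fun m => decide (∀ j : Fin 18, dot m 0 j % 3 ≠ 0) := by
    intro l
    induction l with
    | nil => simp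
    | cons a l ih =>
      intro hl
      rw [List.foldr_cons, ih fun a ha => hl a (List.mem_cons_of_mem _ ha), forceNat_eq, search_eq,
        List.flatMap_cons, List.filter_append, List.filter_map, List.filter_map, List.map_map]
      congr 2
      refine List.filter_congr fun b _ => ?_
      rw [Bool.eq_iff_iff]
      simpa using land_word_eq_zero (b := b) (hl a List.mem_cons_self)
  rw [survivors, forceList_eq, messages_add]
  exact aux _ fun a ha => (mem_messages.1 ha).1

lemma nodup_survivors : survivors.Nodup :=
  survivors_eq ▸ (nodup_messages _).filter _

lemma mem_survivors {m : List ℕ} :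
    m ∈ survivors ↔ m ∈ messages 18 ∧ ∀ j : Fin 18, dot m 0 j % 3 ≠ 0 := by
  simp [survivors_eq]

lemma tallies_survivors : tallies survivors = [888, 408, 70, 408] := by
  decide +kernel

/-- The position of an element of `GF(17) ∪ {∞}` in the order `∞, 0, 1, …, 16`. -/
def pos : Option (ZMod 17) → Fin 18
  | none => 0
  | some a => Fin.succ a

/-- The element of `GF(17) ∪ {∞}` at a given position. -/
def label (i : Fin 18) : Option (ZMod 17) :=
  Fin.cases none some i

/-- The order `∞, 0, 1, …, 16` of `GF(17) ∪ {∞}`. -/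
def labelEquiv : Fin 18 ≃ Option (ZMod 17) where
  toFun := label
  invFun := pos
  left_inv i := by cases i using Fin.cases <;> rfl
  right_inv i := by cases i <;> rfl

lemma Umat_cast (i k : Option (ZMod 17)) :
    ((Umat (ZMod 17) i k : ℤ) : ZMod 3) = (entry (pos i) (pos k) : ℕ) := by
  revert i k
  decide +kernel

lemma mem_Lcode {c : Option (ZMod 17) ⊕ Option (ZMod 17) → ZMod 3} :
    c ∈ Lcode (ZMod 17) ↔
      ∀ k, c (.inr k) = ∑ i, c (.inl i) * ((Umat (ZMod 17) i k : ℤ) : ZMod 3) := by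
  rw [Lcode, Submodule.mem_span_range_iff_exists_fun]
  constructor
  · rintro ⟨x, rfl⟩ k
    simp [genRowL, Finset.sum_apply]
  · intro h
    refine ⟨fun i => c (.inl i), ?_⟩
    ext (k | k)
    · simp [genRowL, Finset.sum_apply]
    · simp [genRowL, Finset.sum_apply, h k]

/-- The codeword with a given message. -/
def codeword (m : List ℕ) : Option (ZMod 17) ⊕ Option (ZMod 17) → ZMod 3
  | .inl i => m.getD (pos i) 0
  | .inr k => dot m 0 (pos k)

/-- The message of a codeword. -/
def message (c : Option (ZMod 17) ⊕ Option (ZMod 17) → ZMod 3) : List ℕ :=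
  List.ofFn fun i => (c (.inl (label i))).val

lemma codeword_mem {m : List ℕ} (hm : m.length = 18) : codeword m ∈ Lcode (ZMod 17) := by
  refine mem_Lcode.2 fun k => ?_
  simp only [codeword, Umat_cast, dot_eq_sum, hm, zero_add]
  have hp : ∀ i, pos (labelEquiv i) = i := labelEquiv.symm_apply_apply
  rw [Finset.sum_range, ← labelEquiv.sum_comp, Nat.cast_sum]
  exact Finset.sum_congr rfl fun i _ => by rw [hp, Nat.cast_mul]

lemma codeword_message {c : Option (ZMod 17) ⊕ Option (ZMod 17) → ZMod 3}
    (hc : c ∈ Lcode (ZMod 17)) : codeword (message c) = c := by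
  have hl : ∀ i, codeword (message c) (.inl i) = c (.inl i) := fun i => by
    have : label (pos i) = i := labelEquiv.apply_symm_apply i
    rw [codeword, message, List.getD_eq_getElem _ _ (by simp), List.getElem_ofFn]
    simp only [Fin.eta, this, ZMod.natCast_zmod_val]
  ext (k | k)
  · rw [hl]
  · rw [mem_Lcode.1 (codeword_mem (by simp [message])), mem_Lcode.1 hc]
    simp only [hl]

lemma message_codeword {m : List ℕ} (hm : m ∈ messages 18) : message (codeword m) = m := by
  obtain ⟨hl, h⟩ := mem_messages.1 hm
  refine List.ext_getElem (by simp [message, hl]) fun i h₁ h₂ => ?_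
  have hp : ∀ i, pos (label i) = i := labelEquiv.symm_apply_apply
  have := h _ (List.getElem_mem h₂)
  simp only [message, codeword, List.getElem_ofFn, hp, List.getD_eq_getElem _ _ h₂]
  rcases this with h | h <;> rw [h] <;> rfl

lemma forall_label {p : Option (ZMod 17) → Prop} : (∀ i, p i) ↔ ∀ j, p (label j) :=
  labelEquiv.forall_congr_right.symm

lemma natCast_eq_iff (n : ℕ) {a : ℕ} (ha : a < 3) : (n : ZMod 3) = a ↔ n % 3 = a := by
  rw [ZMod.natCast_eq_natCast_iff', Nat.mod_eq_of_lt ha]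

lemma codeword_ne_zero {m : List ℕ} (hm : m ∈ messages 18) :
    (∀ j, codeword m j ≠ 0) ↔ m ∈ survivors := by
  obtain ⟨hl, h⟩ := mem_messages.1 hm
  have hp : ∀ i, pos (label i) = i := labelEquiv.symm_apply_apply
  have key (n : ℕ) : (n : ZMod 3) = 0 ↔ n % 3 = 0 := natCast_eq_iff n (a := 0) (by norm_num)
  simp only [Sum.forall, mem_survivors, hm, true_and, codeword, forall_label, hp, ne_eq, key,
    and_iff_right_iff_imp]
  intro _ j
  have hj : (j : ℕ) < m.length := by rw [hl]; exact j.2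
  rw [List.getD_eq_getElem _ _ hj]
  rcases h _ (List.getElem_mem hj) with h | h <;> rw [h] <;> norm_num

lemma message_mem {c : Option (ZMod 17) ⊕ Option (ZMod 17) → ZMod 3} (hc : ∀ j, c j ≠ 0) :
    message c ∈ messages 18 := by
  refine mem_messages.2 ⟨by simp [message], fun x hx => ?_⟩
  obtain ⟨i, rfl⟩ := (List.mem_ofFn' _ _).1 hx
  have : ∀ a : ZMod 3, a ≠ 0 → a.val = 1 ∨ a.val = 2 := by decide
  exact this _ (hc _)

lemma countP_range_beq_one (f : ℕ → ℕ) (n : ℕ) :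
    (List.range n).countP (fun j => (f j % 3).beq 1) =
      ∑ j : Fin n, if f j % 3 = 1 then 1 else 0 := by
  rw [← Finset.sum_range fun j => if f j % 3 = 1 then 1 else 0]
  induction n with
  | zero => rfl
  | succ n ih =>
    rw [List.range_succ, List.countP_append, ih, Finset.sum_range_succ]
    simp [List.countP_singleton]

lemma cnt_codeword_one {m : List ℕ} : cnt (codeword m) 1 = ones m := by
  have hp : ∀ i, pos (label i) = i := labelEquiv.symm_apply_apply
  have key (n : ℕ) : (n : ZMod 3) = 1 ↔ n % 3 = 1 := by
    simpa using natCast_eq_iff n (a := 1) (by norm_num)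
  rw [cnt, Finset.card_filter, Fintype.sum_sum_type, ones, countP_range_beq_one,
    countP_range_beq_one, ← labelEquiv.sum_comp, ← labelEquiv.sum_comp]
  simp [codeword, labelEquiv, hp, key]

lemma cnt_sum (c : Option (ZMod 17) ⊕ Option (ZMod 17) → ZMod 3) :
    cnt c 0 + cnt c 1 + cnt c 2 = 36 := by
  have := Finset.card_eq_sum_card_fiberwise (f := c) (s := univ) (t := univ) (by simp)
  have h3 : ∀ f : ZMod 3 → ℕ, ∑ a, f a = f 0 + f 1 + f 2 := fun f => Fin.sum_univ_three f
  rw [h3] at this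
  exact this.symm

lemma cnt_zero {c : Option (ZMod 17) ⊕ Option (ZMod 17) → ZMod 3} :
    cnt c 0 = 0 ↔ ∀ j, c j ≠ 0 := by
  simp [cnt, Finset.filter_eq_empty_iff]

lemma setOf_eq_image (p : ℕ → Prop) [DecidablePred p] :
    {c | c ∈ Lcode (ZMod 17) ∧ (∀ j, c j ≠ 0) ∧ p (cnt c 1)} =
      codeword '' {m | m ∈ survivors.filter fun m => p (ones m)} := by
  ext c
  constructor
  · rintro ⟨hc, h0, hp⟩
    refine ⟨message c, ?_, codeword_message hc⟩
    have hm := message_mem h0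
    simp only [List.mem_filter, Set.mem_ofPred_eq, ← codeword_ne_zero hm, ← cnt_codeword_one,
      codeword_message hc]
    exact ⟨h0, by simpa using hp⟩
  · rintro ⟨m, hm, rfl⟩
    obtain ⟨hm, hp⟩ := List.mem_filter.1 hm
    have hm' := (mem_survivors.1 hm).1
    exact ⟨codeword_mem (mem_messages.1 hm').1, (codeword_ne_zero hm').2 hm,
      by simpa [cnt_codeword_one] using hp⟩

lemma codeword_injOn : Set.InjOn codeword {m | m ∈ messages 18} :=
  Set.LeftInvOn.injOn (f₁' := message) fun _ hm => message_codeword hm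

lemma ncard_setOf (p : ℕ → Prop) [DecidablePred p] :
    {c | c ∈ Lcode (ZMod 17) ∧ (∀ j, c j ≠ 0) ∧ p (cnt c 1)}.ncard =
      (survivors.map ones).countP (p ·) := by
  have hinj : Set.InjOn codeword {m | m ∈ survivors.filter fun m => p (ones m)} :=
    codeword_injOn.mono fun m hm => (mem_survivors.1 (List.mem_filter.1 hm).1).1
  rw [setOf_eq_image, hinj.ncard_image, ← List.coe_toFinset, Set.ncard_coe_finset,
    List.toFinset_card_of_nodup (nodup_survivors.filter _), List.countP_map,
    List.countP_eq_length_filter]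
  rfl

lemma countP_ones : survivors.length = 888 ∧ (survivors.map ones).countP (· = 15) = 408 ∧
    (survivors.map ones).countP (· = 18) = 70 ∧ (survivors.map ones).countP (· = 21) = 408 := by
  have h := tallies_survivors
  have hbeq (n : ℕ) : (fun a : ℕ => a.beq n) = fun a => decide (a = n) := by
    ext a
    rw [Bool.eq_iff_iff, Nat.beq_eq, decide_eq_true_iff]
  simp only [tallies, forceList_eq, tally, List.map_map, hbeq, List.length_map, List.cons.injEq,
    and_true, Function.comp_def] at h
  exact h

lemma setOf_cnt_eq {a b : ℕ} (h : a + b = 36) :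
    {c | c ∈ Lcode (ZMod 17) ∧ cnt c 1 = a ∧ cnt c 2 = b} =
      {c | c ∈ Lcode (ZMod 17) ∧ (∀ j, c j ≠ 0) ∧ cnt c 1 = a} := by
  ext c
  have := cnt_sum c
  simp only [Set.mem_ofPred_eq, ← cnt_zero]
  refine and_congr_right fun _ => ?_
  omega

/-- The entries of the Hadamard matrix `H` modulo 3 as natural numbers. -/
def hadamardEntry : Option (ZMod 17) ⊕ Option (ZMod 17) → Option (ZMod 17) ⊕ Option (ZMod 17) → ℕ
  | .inl i, .inl j => (if i = j then 1 else 0) + 2 * entry (pos j) (pos i)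
  | .inl i, .inr j => entry (pos i) (pos j) + if i = j then 1 else 0
  | .inr i, .inl j => (if i = j then 1 else 0) + entry (pos j) (pos i)
  | .inr i, .inr j => entry (pos i) (pos j) + 2 * if i = j then 1 else 0

lemma Hmat_cast (i j : Option (ZMod 17) ⊕ Option (ZMod 17)) :
    ((Hmat (ZMod 17) i j : ℤ) : ZMod 3) = hadamardEntry i j := by
  have h2 : (2 : ZMod 3) = -1 := rfl
  rcases i with i | i <;> rcases j with j | j <;>
    simp only [Hmat, fromBlocks_apply₁₁, fromBlocks_apply₁₂, fromBlocks_apply₂₁,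
      fromBlocks_apply₂₂, Matrix.sub_apply, Matrix.add_apply, Matrix.transpose_apply,
      Matrix.one_apply, hadamardEntry, Int.cast_sub, Int.cast_add, Umat_cast] <;>
    push_cast [h2] <;> ring

/-- The message of row `i` of `H` or, if `s` is false, of `2 H`. -/
def rowMessage (s : Bool) (i : Option (ZMod 17) ⊕ Option (ZMod 17)) : List ℕ :=
  (List.finRange 18).map fun j => (if s then 1 else 2) * hadamardEntry i (.inl (label j)) % 3

lemma rowMessage_mem : ∀ s i, (∀ x ∈ rowMessage s i, x = 1 ∨ x = 2) := by
  decide +kernel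

lemma dot_rowMessage : ∀ s i k, dot (rowMessage s i) 0 (pos k) % 3 =
    (if s then 1 else 2) * hadamardEntry i (.inr k) % 3 ∧
    dot (rowMessage s i) 0 (pos k) % 3 ≠ 0 := by
  decide +kernel

lemma ones_rowMessage : ∀ s i, i ≠ .inl none → ones (rowMessage s i) = 18 := by
  decide +kernel

/-- The indices of the rows of `H` other than the all-one row. -/
def rows : List (Option (ZMod 17) ⊕ Option (ZMod 17)) :=
  (List.finRange 17).map (fun i => .inl (some i)) ++ (List.finRange 18).map fun i => .inr (label i)

/-- The messages of the rows of `H` and `2 H` other than the constant ones. -/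
def rowMessages : List (List ℕ) :=
  rows.map (rowMessage true) ++ rows.map (rowMessage false)

lemma nodup_rowMessages : rowMessages.Nodup := by
  decide +kernel

lemma mem_rows {i : Option (ZMod 17) ⊕ Option (ZMod 17)} : i ∈ rows ↔ i ≠ .inl none := by
  rw [rows, List.mem_append]
  rcases i with (_ | a) | k
  · simp
  · exact iff_of_true (.inl (List.mem_map.2 ⟨a, List.mem_finRange a, rfl⟩)) (by simp)
  · exact iff_of_true (.inr (List.mem_map.2 ⟨pos k, List.mem_finRange _,
      congrArg _ (labelEquiv.apply_symm_apply k)⟩)) (by simp)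

lemma codeword_rowMessage (s : Bool) (i : Option (ZMod 17) ⊕ Option (ZMod 17)) :
    codeword (rowMessage s i) =
      fun j => (if s then 1 else 2) * ((Hmat (ZMod 17) i j : ℤ) : ZMod 3) := by
  have hs : (if s then 1 else 2 : ZMod 3) = ((if s then 1 else 2 : ℕ) : ZMod 3) := by
    cases s <;> rfl
  have hlp (k) : label (pos k) = k := labelEquiv.apply_symm_apply k
  funext j
  rw [Hmat_cast, hs, ← Nat.cast_mul]
  rcases j with k | k
  · rw [codeword, rowMessage, List.getD_eq_getElem _ _ (by simp), List.getElem_map,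
      List.getElem_finRange]
    simp [hlp, ZMod.natCast_mod]
  · exact (ZMod.natCast_eq_natCast_iff' _ _ _).2 (dot_rowMessage s i k).1

lemma rowMessage_mem_messages (s : Bool) (i : Option (ZMod 17) ⊕ Option (ZMod 17)) :
    rowMessage s i ∈ messages 18 :=
  mem_messages.2 ⟨by simp [rowMessage], rowMessage_mem s i⟩

lemma rowMessage_mem_survivors (s : Bool) (i : Option (ZMod 17) ⊕ Option (ZMod 17)) :
    rowMessage s i ∈ survivors := by
  refine mem_survivors.2 ⟨rowMessage_mem_messages s i, fun j => ?_⟩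
  have := (dot_rowMessage s i (label j)).2
  rwa [show pos (label j) = j from labelEquiv.symm_apply_apply j] at this

lemma mem_rowMessages {m : List ℕ} :
    m ∈ rowMessages ↔ ∃ s i, i ≠ .inl none ∧ rowMessage s i = m := by
  simp only [rowMessages, List.mem_append, List.mem_map, mem_rows, Bool.exists_bool]
  exact or_comm

lemma rowMessages_perm : rowMessages.Perm (survivors.filter fun m => ones m = 18) := by
  refine (nodup_rowMessages.subperm fun m hm => ?_).perm_of_length_le ?_
  · obtain ⟨s, i, hi, rfl⟩ := mem_rowMessages.1 hm
    exact List.mem_filter.2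
      ⟨rowMessage_mem_survivors s i, decide_eq_true (ones_rowMessage s i hi)⟩
  · have h := countP_ones.2.2.1
    rw [List.countP_map, List.countP_eq_length_filter] at h
    exact h.le

/-- The code `L(17)` of length 36 contains exactly 888 codewords of weight 36, and these
are exactly: the all-one vector `1̄` and `2·1̄`; 70 codewords with 18 ones and 18 twos,
namely the rows of `H` and `2H` (mod 3) other than `1̄` and `2·1̄`; exactly 408 codewords
with 15 ones and 21 twos; and exactly 408 codewords with 21 ones and 15 twos. -/
theorem stmt_7 :
    -- the constant vectors are codewords of weight 36
    (fun _ : Option (ZMod 17) ⊕ Option (ZMod 17) => (1 : ZMod 3)) ∈ Lcode (ZMod 17) ∧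
    (fun _ : Option (ZMod 17) ⊕ Option (ZMod 17) => (2 : ZMod 3)) ∈ Lcode (ZMod 17) ∧
    -- there are exactly 888 codewords of weight 36
    Set.ncard {c : (Option (ZMod 17) ⊕ Option (ZMod 17)) → ZMod 3 |
      c ∈ Lcode (ZMod 17) ∧ ∀ j, c j ≠ 0} = 888 ∧
    -- the codewords with 18 ones and 18 twos are exactly the rows of H and 2H
    -- other than 1̄ and 2·1̄
    {c : (Option (ZMod 17) ⊕ Option (ZMod 17)) → ZMod 3 |
        c ∈ Lcode (ZMod 17) ∧ cnt c 1 = 18 ∧ cnt c 2 = 18} =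
      {c | ∃ (s : Bool) (i : Option (ZMod 17) ⊕ Option (ZMod 17)), i ≠ Sum.inl none ∧
        c = fun j => (if s then 1 else 2) * ((Hmat (ZMod 17) i j : ℤ) : ZMod 3)} ∧
    Set.ncard {c : (Option (ZMod 17) ⊕ Option (ZMod 17)) → ZMod 3 |
      c ∈ Lcode (ZMod 17) ∧ cnt c 1 = 18 ∧ cnt c 2 = 18} = 70 ∧
    -- 408 codewords with 15 ones and 21 twos
    Set.ncard {c : (Option (ZMod 17) ⊕ Option (ZMod 17)) → ZMod 3 |
      c ∈ Lcode (ZMod 17) ∧ cnt c 1 = 15 ∧ cnt c 2 = 21} = 408 ∧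
    -- 408 codewords with 21 ones and 15 twos
    Set.ncard {c : (Option (ZMod 17) ⊕ Option (ZMod 17)) → ZMod 3 |
      c ∈ Lcode (ZMod 17) ∧ cnt c 1 = 21 ∧ cnt c 2 = 15} = 408 := by
  have hone := codeword_rowMessage true (.inl none)
  have htwo := codeword_rowMessage false (.inl none)
  have hrow : ∀ j, ((Hmat (ZMod 17) (.inl none) j : ℤ) : ZMod 3) = 1 := by
    simp only [Hmat_cast]
    decide +kernel
  have hmem (s i) := codeword_mem (mem_messages.1 (rowMessage_mem_messages s i)).1
  simp only [hrow] at hone htwo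
  obtain ⟨htotal, h15, h18, h21⟩ := countP_ones
  refine ⟨hone ▸ hmem _ _, htwo ▸ hmem _ _, ?_, ?_, ?_, ?_, ?_⟩
  · simpa [htotal] using ncard_setOf fun _ => True
  · rw [setOf_cnt_eq rfl, setOf_eq_image (· = 18)]
    ext c
    simp only [← rowMessages_perm.mem_iff, mem_rowMessages, Set.mem_image, Set.mem_ofPred_eq,
      ← codeword_rowMessage]
    grind
  · rw [setOf_cnt_eq rfl, ncard_setOf (· = 18), h18]
  · rw [setOf_cnt_eq rfl, ncard_setOf (· = 15), h15]
  · rw [setOf_cnt_eq rfl, ncard_setOf (· = 21), h21]
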